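/- Let l ≥ 2 and N ≥ 1 be integers, let σ² = sin(π/(2l))/sin(3π/(2l)), let f_l(ξ) = (l/π)·sin(π/(2l))/(1 + ξ^{2l}), let g(t) = ∫_{-∞}^{∞} e^{itξ} f_l(ξ) dξ be its characteristic function, and define p_N(z) = (1/(2π)) ∫_{-∞}^{∞} g(ω/(σ√N))^N e^{−iωz} dω (the integral converges absolutely since |g| decays exponentially). Then z^{2l} · p_N(z) converges, as z → +∞, to N·l·sin(π/(2l)) / (π·(σ√N)^{2l−1}). -/

import Mathlib

open MeasureTheory Real Complex Filter

open scoped Topology FourierTransform Convolution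

/-- A bounded continuous integrable function on `ℝ` with `u x ∼ A / x ^ m` at `+∞`. -/
structure HasPowerTail (u : ℝ → ℂ) (m : ℕ) (A : ℂ) : Prop where
  continuous : Continuous u
  integrable : Integrable u
  bounded : ∃ K, ∀ x, ‖u x‖ ≤ K
  tendsto : Tendsto (fun x : ℝ => (x : ℂ) ^ m * u x) atTop (𝓝 A)

lemma HasPowerTail.tendsto_half {u v : ℝ → ℂ} {m : ℕ} {A B : ℂ}
    (hu : HasPowerTail u m A) (hv : HasPowerTail v m B) :
    Tendsto (fun x : ℝ => (x : ℂ) ^ m * ∫ y in Set.Iic (x / 2), u (x - y) * v y) atTop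
      (𝓝 (A * ∫ y, v y)) := by
  obtain ⟨R, hR⟩ : ∃ R : ℝ, ∀ x ≥ R, ‖(x : ℂ) ^ m * u x‖ ≤ ‖A‖ + 1 := by
    have h := hu.tendsto.norm.eventually_le_const (lt_add_one ‖A‖)
    exact eventually_atTop.1 h
  have key : Tendsto (fun x : ℝ => ∫ y, (Set.Iic (x / 2)).indicator
      (fun y => (x : ℂ) ^ m * (u (x - y) * v y)) y) atTop (𝓝 (∫ y, A * v y)) := by
    refine tendsto_integral_filter_of_dominated_convergence
      (fun y => 2 ^ m * (‖A‖ + 1) * ‖v y‖) ?_ ?_ (hv.integrable.norm.const_mul _) ?_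
    · refine Eventually.of_forall fun x => ?_
      refine (Continuous.aestronglyMeasurable ?_).indicator measurableSet_Iic
      have := hu.continuous
      have := hv.continuous
      fun_prop
    · filter_upwards [eventually_ge_atTop (2 * R), eventually_gt_atTop 0] with x hx hx0
      refine Eventually.of_forall fun y => ?_
      by_cases hy : y ∈ Set.Iic (x / 2)
      · rw [Set.indicator_of_mem hy, ← mul_assoc, norm_mul]
        have hy' : y ≤ x / 2 := hy
        have h1 := hR (x - y) (by linarith)
        gcongr
        calc ‖(x : ℂ) ^ m * u (x - y)‖ ≤ 2 ^ m * ‖((x - y : ℝ) : ℂ) ^ m * u (x - y)‖ := by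
              rw [norm_mul, norm_mul, ← mul_assoc, norm_pow, norm_pow, ← mul_pow,
                Complex.norm_real, Complex.norm_real, Real.norm_of_nonneg hx0.le,
                Real.norm_of_nonneg (by linarith)]
              gcongr
              linarith
          _ ≤ _ := by gcongr
      · rw [Set.indicator_of_notMem hy, norm_zero]
        positivity
    · refine Eventually.of_forall fun y => ?_
      have hsub : Tendsto (fun x : ℝ => x - y) atTop atTop :=
        tendsto_atTop_add_const_right _ (-y) tendsto_id
      have hratio : Tendsto (fun x : ℝ => ((x / (x - y) : ℝ) : ℂ) ^ m) atTop (𝓝 1) := by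
        have h0 : Tendsto (fun x : ℝ => 1 + y / (x - y)) atTop (𝓝 (1 + 0)) :=
          tendsto_const_nhds.add (tendsto_const_nhds.div_atTop hsub)
        have h1 : Tendsto (fun x : ℝ => x / (x - y)) atTop (𝓝 1) := by
          rw [add_zero] at h0
          refine h0.congr' ?_
          filter_upwards [eventually_gt_atTop y] with x hx
          have : x - y ≠ 0 := by linarith
          field_simp
          ring
        simpa using (Complex.continuous_ofReal.continuousAt.tendsto.comp h1).pow m
      have hlim := (hratio.mul (hu.tendsto.comp hsub)).mul_const (v y)
      rw [one_mul] at hlim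
      refine hlim.congr' ?_
      filter_upwards [eventually_gt_atTop y, eventually_ge_atTop (2 * y)] with x hx hx2
      rw [Set.indicator_of_mem (show y ∈ Set.Iic (x / 2) by simp; linarith)]
      have : ((x : ℂ) - y) ≠ 0 := by
        rw [← Complex.ofReal_sub]; exact_mod_cast (by linarith : x - y ≠ 0)
      simp only [Function.comp]
      push_cast
      rw [div_pow]
      field_simp
  rw [integral_const_mul] at key
  refine key.congr fun x => ?_
  rw [integral_indicator measurableSet_Iic, integral_const_mul]

lemma HasPowerTail.convolution {u v : ℝ → ℂ} {m : ℕ} {A B : ℂ}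
    (hu : HasPowerTail u m A) (hv : HasPowerTail v m B) :
    HasPowerTail (u ⋆[ContinuousLinearMap.mul ℂ ℂ] v) m (A * (∫ y, v y) + B * ∫ y, u y) := by
  obtain ⟨K, hK⟩ := hv.bounded
  have hint : ∀ x, Integrable fun t => u t * v (x - t) := fun x =>
    hu.integrable.mul_bdd
      (hv.continuous.comp (continuous_sub_left x)).aestronglyMeasurable
      (Eventually.of_forall fun t => hK _)
  refine ⟨?_, hu.integrable.integrable_convolution _ hv.integrable, ⟨(∫ t, ‖u t‖) * K, ?_⟩, ?_⟩
  · refine BddAbove.continuous_convolution_right_of_integrable _ ?_ hu.integrable hv.continuous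
    exact ⟨K, by rintro _ ⟨x, rfl⟩; exact hK x⟩
  · intro x
    rw [convolution_def, ← integral_mul_const]
    refine norm_integral_le_of_norm_le (hu.integrable.norm.mul_const _)
      (Eventually.of_forall fun t => ?_)
    rw [ContinuousLinearMap.mul_apply', norm_mul]
    gcongr
    exact hK _
  · refine ((hu.tendsto_half hv).add (hv.tendsto_half hu)).congr fun x => ?_
    rw [convolution_def, ← mul_add]
    congr 1
    simp only [ContinuousLinearMap.mul_apply']
    rw [← integral_add_compl (measurableSet_Iic (a := x / 2)) (hint x), add_comm]
    congr 1
    · simp_rw [mul_comm]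
    · rw [integral_Iic_eq_integral_Iio, ← integral_indicator measurableSet_Iio,
        ← integral_indicator measurableSet_Iic.compl,
        ← integral_sub_left_eq_self _ _ x]
      congr 1
      ext t
      simp only [Set.indicator, Set.mem_Iio, Set.mem_compl_iff, Set.mem_Iic, sub_sub_cancel]
      congr 1
      simp only [not_le, eq_iff_iff]
      constructor <;> intro h <;> linarith

/-- If `f` has integrable first and second derivatives, its Fourier transform is integrable. -/
lemma integrable_fourier_of_hasDerivAt {f f' f'' : ℝ → ℂ}
    (hf : Integrable f) (hf' : Integrable f') (hf'' : Integrable f'')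
    (h1 : ∀ x, HasDerivAt f (f' x) x) (h2 : ∀ x, HasDerivAt f' (f'' x) x) :
    Integrable (𝓕 f) := by
  have e1 : deriv f = f' := funext fun x => (h1 x).deriv
  have e2 : deriv f' = f'' := funext fun x => (h2 x).deriv
  have F1 := Real.fourier_deriv hf (fun x => (h1 x).differentiableAt) (e1 ▸ hf')
  have F2 := Real.fourier_deriv hf' (fun x => (h2 x).differentiableAt) (e2 ▸ hf'')
  rw [e1] at F1
  rw [e2, F1] at F2
  have bound : ∀ (h : ℝ → ℂ) (w : ℝ), ‖𝓕 h w‖ ≤ ∫ x, ‖h x‖ := fun h w =>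
    VectorFourier.norm_fourierIntegral_le_integral_norm 𝐞 _ _ h w
  refine (integrable_inv_one_add_sq.const_mul ((∫ x, ‖f x‖) + ∫ x, ‖f'' x‖)).mono'
    (VectorFourier.fourierIntegral_continuous Real.continuous_fourierChar
      (by exact continuous_inner) hf).aestronglyMeasurable (Eventually.of_forall fun w => ?_)
  have b1 := bound f w
  have b2 := bound f'' w
  rw [F2] at b2
  simp only [norm_smul, norm_mul, Complex.norm_real, Complex.norm_I, Real.norm_eq_abs,
    Complex.norm_ofNat, mul_one, abs_of_pos Real.pi_pos] at b2
  rw [← div_eq_mul_inv, le_div_iff₀ (by positivity)]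
  have h3 : w ^ 2 * ‖𝓕 f w‖ ≤ 2 * π * |w| * (2 * π * |w| * ‖𝓕 f w‖) := by
    have : 2 * π * |w| * (2 * π * |w| * ‖𝓕 f w‖) = (2 * π) ^ 2 * (w ^ 2 * ‖𝓕 f w‖) := by
      rw [← sq_abs w]; ring
    rw [this]
    refine le_mul_of_one_le_left (by positivity) ?_
    nlinarith [Real.pi_gt_three]
  change ‖𝓕 f w‖ * (1 + w ^ 2) ≤ _
  linarith
lemma abs_pow_mul_one_add_sq_le {l : ℕ} (hl : 2 ≤ l) (x : ℝ) :
    |x| ^ (2 * l - 2) * (1 + x ^ 2) ≤ 2 * (1 + x ^ (2 * l)) := by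
  obtain ⟨k, rfl⟩ : ∃ k, l = k + 1 := ⟨l - 1, by omega⟩
  rw [show 2 * (k + 1) - 2 = 2 * k by omega, pow_mul, sq_abs, pow_mul, pow_succ (x ^ 2)]
  have hy : 0 ≤ x ^ 2 := sq_nonneg x
  generalize x ^ 2 = y at *
  rcases le_total y 1 with h | h
  · have : y ^ k ≤ 1 := pow_le_one₀ hy h
    nlinarith [pow_nonneg hy k]
  · have : 0 < y ^ k := by positivity
    nlinarith

lemma one_add_sq_le {l : ℕ} (hl : 2 ≤ l) (x : ℝ) : 1 + x ^ 2 ≤ 2 * (1 + x ^ (2 * l)) := by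
  rw [pow_mul]
  have hy : 0 ≤ x ^ 2 := sq_nonneg x
  generalize x ^ 2 = y at *
  rcases le_total y 1 with h | h
  · nlinarith [pow_nonneg hy l]
  · nlinarith [le_self_pow₀ h (by omega : l ≠ 0)]

lemma one_add_pow_two_mul_pos (l : ℕ) (x : ℝ) : 0 < 1 + x ^ (2 * l) := by
  have : 0 ≤ x ^ (2 * l) := (even_two_mul l).pow_nonneg x
  linarith

lemma integrable_inv_one_add_pow {l : ℕ} (hl : 2 ≤ l) :
    Integrable fun x : ℝ => (1 + x ^ (2 * l))⁻¹ := by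
  refine (integrable_inv_one_add_sq.const_mul 2).mono'
    (Continuous.aestronglyMeasurable ?_) (Eventually.of_forall fun x => ?_)
  · exact Continuous.inv₀ (by fun_prop) fun x => (one_add_pow_two_mul_pos l x).ne'
  · have h0 := one_add_pow_two_mul_pos l x
    rw [Real.norm_of_nonneg (by positivity), ← div_eq_mul_inv, inv_eq_one_div,
      div_le_div_iff₀ h0 (by positivity)]
    linarith [one_add_sq_le hl x]

lemma integral_Ioi_inv_one_add_rpow {n : ℝ} (hn : 1 < n)
    (hint : IntegrableOn (fun x : ℝ => (1 + x ^ n)⁻¹) (Set.Ioi 0)) :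
    ∫ x in Set.Ioi (0 : ℝ), (1 + x ^ n)⁻¹ = π / n / Real.sin (π / n) := by
  have hn0 : 0 < n := by linarith
  have inner_t : ∀ x ∈ Set.Ioi (0 : ℝ),
      ∫ t in Set.Ioi (0 : ℝ), Real.exp (-(1 + x ^ n) * t) = (1 + x ^ n)⁻¹ := fun x hx => by
    have hx : (0 : ℝ) < x := hx
    have h : 0 < 1 + x ^ n := by positivity
    rw [integral_exp_mul_Ioi (by linarith)]
    rw [mul_zero, Real.exp_zero, neg_div_neg_eq, one_div]
  have inner_x : ∀ t ∈ Set.Ioi (0 : ℝ),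
      ∫ x in Set.Ioi (0 : ℝ), Real.exp (-(1 + x ^ n) * t) =
        (1 / n * Real.Gamma (1 / n)) * (t ^ ((1 - 1 / n) - 1) * Real.exp (-(1 * t))) :=
      fun t ht => by
    have := integral_rpow_mul_exp_neg_mul_rpow hn0 (by norm_num : (-1 : ℝ) < 0) ht
    simp only [Real.rpow_zero, one_mul, zero_add] at this
    have e : ∀ x : ℝ, Real.exp (-(1 + x ^ n) * t) = Real.exp (-t) * Real.exp (-t * x ^ n) :=
      fun x => by rw [← Real.exp_add]; ring_nf
    simp_rw [e]
    rw [integral_const_mul, this, show (1 - 1 / n) - 1 = -1 / n by ring, one_mul]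
    ring
  have hprod : Integrable (Function.uncurry fun x t : ℝ => Real.exp (-(1 + x ^ n) * t))
      ((volume.restrict (Set.Ioi 0)).prod (volume.restrict (Set.Ioi 0))) := by
    rw [integrable_prod_iff (Measurable.aestronglyMeasurable (by
      unfold Function.uncurry; fun_prop))]
    constructor
    · filter_upwards [ae_restrict_mem measurableSet_Ioi] with x hx
      have hx : (0 : ℝ) < x := hx
      have h : 0 < 1 + x ^ n := by positivity
      exact integrableOn_exp_mul_Ioi (neg_neg_of_pos h) 0
    · refine hint.congr ?_
      filter_upwards [ae_restrict_mem measurableSet_Ioi] with x hx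
      simp only [Function.uncurry, Real.norm_eq_abs, Real.abs_exp]
      exact (inner_t x hx).symm
  have hn1 : 1 / n < 1 := by rw [div_lt_one hn0]; exact hn
  rw [← setIntegral_congr_fun measurableSet_Ioi inner_t, integral_integral_swap hprod,
    setIntegral_congr_fun measurableSet_Ioi inner_x, integral_const_mul,
    Real.integral_rpow_mul_exp_neg_mul_Ioi (by linarith) one_pos, div_one, Real.one_rpow, one_mul,
    mul_assoc, Real.Gamma_mul_Gamma_one_sub]
  ring_nf

lemma integral_inv_one_add_pow {l : ℕ} (hl : 2 ≤ l) :
    ∫ x : ℝ, (1 + x ^ (2 * l))⁻¹ = π / l / Real.sin (π / (2 * l)) := by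
  have h := integral_Ioi_inv_one_add_rpow (n := ((2 * l : ℕ) : ℝ))
    (by exact_mod_cast (by omega : 1 < 2 * l))
    (by simp_rw [Real.rpow_natCast]; exact (integrable_inv_one_add_pow hl).integrableOn)
  simp_rw [Real.rpow_natCast] at h
  have habs := integral_comp_abs (f := fun x : ℝ => (1 + x ^ (2 * l))⁻¹)
  simp only [(even_two_mul l).pow_abs] at habs
  rw [habs, h]
  push_cast
  ring

/-- The complex-valued function `c / (1 + x ^ (2 * l))`. -/
noncomputable def powerDensity (l : ℕ) (c : ℝ) (x : ℝ) : ℂ := ((c / (1 + x ^ (2 * l)) : ℝ) : ℂ)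

lemma continuous_powerDensity (l : ℕ) (c : ℝ) : Continuous (powerDensity l c) :=
  Complex.continuous_ofReal.comp <|
    Continuous.div (by fun_prop) (by fun_prop) fun x => (one_add_pow_two_mul_pos l x).ne'

lemma integrable_powerDensity {l : ℕ} (hl : 2 ≤ l) (c : ℝ) : Integrable (powerDensity l c) :=
  ((integrable_inv_one_add_pow hl).const_mul c).ofReal

lemma integrable_fourier_powerDensity {l : ℕ} (hl : 2 ≤ l) (c : ℝ) :
    Integrable (𝓕 (powerDensity l c)) := by
  have hD : ∀ x : ℝ, 1 + x ^ (2 * l) ≠ 0 := fun x => (one_add_pow_two_mul_pos l x).ne'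
  let d₁ : ℝ → ℝ := fun x => -(c * ((2 * l : ℕ) * x ^ (2 * l - 1))) / (1 + x ^ (2 * l)) ^ 2
  let d₂ : ℝ → ℝ := fun x => c * (2 * ((2 * l : ℕ) * x ^ (2 * l - 1)) ^ 2 / (1 + x ^ (2 * l)) ^ 3 -
    (2 * l : ℕ) * ((2 * l - 1 : ℕ) * x ^ (2 * l - 2)) / (1 + x ^ (2 * l)) ^ 2)
  have hden : ∀ x : ℝ, HasDerivAt (fun x : ℝ => 1 + x ^ (2 * l))
      ((2 * l : ℕ) * x ^ (2 * l - 1)) x := fun x => (hasDerivAt_pow _ x).const_add 1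
  have h1 : ∀ x : ℝ, HasDerivAt (fun x : ℝ => c / (1 + x ^ (2 * l))) (d₁ x) x := fun x => by
    convert! (hasDerivAt_const x c).div (hden x) (hD x) using 1
    simp only [d₁]
    ring
  have h2 : ∀ x : ℝ, HasDerivAt d₁ (d₂ x) x := fun x => by
    have hnum := (((hasDerivAt_pow (2 * l - 1) x).const_mul ((2 * l : ℕ) : ℝ)).const_mul c).neg
    convert! hnum.div ((hden x).pow 2) (pow_ne_zero 2 (hD x)) using 1
    simp only [d₂, Pi.neg_apply, Pi.pow_apply, show 2 * l - 1 - 1 = 2 * l - 2 by omega]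
    have := hD x
    field_simp
    push_cast
    ring
  have hbound : ∀ x : ℝ, |x| ^ (2 * l - 1) ≤ 1 + x ^ (2 * l) ∧
      |x| ^ (2 * l - 2) ≤ 2 * (1 + x ^ (2 * l)) ∧
      (|x| ^ (2 * l - 1)) ^ 2 ≤ 2 * (1 + x ^ (2 * l)) ^ 2 := fun x => by
    have h := abs_pow_mul_one_add_sq_le hl x
    have hq : 0 ≤ |x| ^ (2 * l - 2) := by positivity
    have e : |x| ^ (2 * l - 1) = |x| ^ (2 * l - 2) * |x| := by
      rw [← pow_succ]; congr 1; omega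
    have hle : |x| ^ (2 * l - 1) ≤ 1 + x ^ (2 * l) := by
      rw [e]
      rw [← sq_abs x] at h
      nlinarith [mul_nonneg hq (sq_nonneg (|x| - 1))]
    refine ⟨hle, ?_, ?_⟩
    · nlinarith [mul_nonneg hq (sq_nonneg x)]
    · have := pow_le_pow_left₀ (by positivity) hle 2
      nlinarith [sq_nonneg (1 + x ^ (2 * l))]
  have hi := integrable_inv_one_add_pow hl
  have c1 : Continuous d₁ := Continuous.div (by fun_prop) (by fun_prop) fun x => pow_ne_zero 2 (hD x)
  have c2 : Continuous d₂ := continuous_const.mul <|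
    (Continuous.div (by fun_prop) (by fun_prop) fun x => pow_ne_zero 3 (hD x)).sub
    (Continuous.div (by fun_prop) (by fun_prop) fun x => pow_ne_zero 2 (hD x))
  have i1 : Integrable d₁ := by
    refine (hi.const_mul (|c| * (2 * l : ℕ))).mono' c1.aestronglyMeasurable
      (Eventually.of_forall fun x => ?_)
    have hp := one_add_pow_two_mul_pos l x
    simp only [d₁]
    rw [Real.norm_eq_abs, abs_div, abs_neg, abs_mul, abs_mul, abs_pow, abs_pow, abs_of_pos hp,
      Nat.abs_cast, div_le_iff₀ (by positivity)]
    calc |c| * ((2 * l : ℕ) * |x| ^ (2 * l - 1)) ≤ |c| * ((2 * l : ℕ) * (1 + x ^ (2 * l))) := by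
          gcongr; exact (hbound x).1
      _ = _ := by field_simp
  have i2 : Integrable d₂ := by
    refine (hi.const_mul (|c| * (4 * (2 * l : ℕ) ^ 2 + (2 * l : ℕ) * ((2 * l - 1 : ℕ) * 2)))).mono'
      c2.aestronglyMeasurable (Eventually.of_forall fun x => ?_)
    have hp := one_add_pow_two_mul_pos l x
    simp only [d₂]
    rw [Real.norm_eq_abs, abs_mul, mul_assoc]
    refine mul_le_mul_of_nonneg_left ((abs_sub _ _).trans ?_) (abs_nonneg c)
    rw [add_mul]
    refine add_le_add ?_ ?_
    · rw [abs_div, abs_mul, abs_pow, abs_mul, abs_pow, abs_pow, abs_of_pos hp, Nat.abs_cast,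
        div_le_iff₀ (by positivity), mul_pow, abs_two]
      calc 2 * (((2 * l : ℕ) : ℝ) ^ 2 * (|x| ^ (2 * l - 1)) ^ 2)
          ≤ 2 * (((2 * l : ℕ) : ℝ) ^ 2 * (2 * (1 + x ^ (2 * l)) ^ 2)) := by
            gcongr; exact (hbound x).2.2
        _ = _ := by field_simp; ring
    · rw [abs_div, abs_mul, abs_mul, abs_pow, abs_pow, abs_of_pos hp, Nat.abs_cast, Nat.abs_cast,
        div_le_iff₀ (by positivity)]
      calc ((2 * l : ℕ) : ℝ) * ((2 * l - 1 : ℕ) * |x| ^ (2 * l - 2))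
          ≤ (2 * l : ℕ) * ((2 * l - 1 : ℕ) * (2 * (1 + x ^ (2 * l)))) := by
            gcongr; exact (hbound x).2.1
        _ = _ := by field_simp
  exact integrable_fourier_of_hasDerivAt (integrable_powerDensity hl c) i1.ofReal i2.ofReal
    (fun x => (h1 x).ofReal_comp) fun x => (h2 x).ofReal_comp

lemma hasPowerTail_powerDensity {l : ℕ} (hl : 2 ≤ l) (c : ℝ) :
    HasPowerTail (powerDensity l c) (2 * l) c := by
  refine ⟨continuous_powerDensity l c, integrable_powerDensity hl c, ⟨|c|, fun x => ?_⟩, ?_⟩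
  · rw [powerDensity, Complex.norm_real, Real.norm_eq_abs, abs_div,
      abs_of_pos (one_add_pow_two_mul_pos l x)]
    refine div_le_self (abs_nonneg c) ?_
    linarith [(even_two_mul l).pow_nonneg x]
  · have hpow : Tendsto (fun x : ℝ => 1 + x ^ (2 * l)) atTop atTop :=
      tendsto_atTop_add_const_left _ _ (tendsto_pow_atTop (by omega))
    have h : Tendsto (fun x : ℝ => c - c / (1 + x ^ (2 * l))) atTop (𝓝 (c - 0)) :=
      tendsto_const_nhds.sub (tendsto_const_nhds.div_atTop hpow)
    rw [sub_zero] at h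
    refine (Complex.continuous_ofReal.continuousAt.tendsto.comp h).congr fun x => ?_
    rw [powerDensity, ← Complex.ofReal_pow, ← Complex.ofReal_mul, Function.comp_apply]
    congr 1
    have := (one_add_pow_two_mul_pos l x).ne'
    field_simp
    ring

lemma HasPowerTail.exists_fourier_eq_pow {u : ℝ → ℂ} {m : ℕ} {A : ℂ} (hu : HasPowerTail u m A)
    (hu1 : ∫ x, u x = 1) (n : ℕ) :
    ∃ F : ℝ → ℂ, HasPowerTail F m ((n + 1 : ℕ) * A) ∧ ∫ x, F x = 1 ∧
      ∀ w, 𝓕 F w = 𝓕 u w ^ (n + 1) := by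
  induction n with
  | zero => exact ⟨u, by simpa using hu, hu1, by simp⟩
  | succ n ih =>
    obtain ⟨F, hF, hF1, hFu⟩ := ih
    refine ⟨_, ?_, ?_, fun w => (Real.fourier_mul_convolution_eq hF.integrable hu.integrable w).trans
      (by rw [hFu, ← pow_succ])⟩
    · convert! hF.convolution hu using 1
      rw [hF1, hu1]
      push_cast
      ring
    · rw [integral_convolution _ hF.integrable hu.integrable, hF1, hu1]
      simp

lemma integrable_fourier_pow {u : ℝ → ℂ} (hu : Integrable u) (h : Integrable (𝓕 u)) (n : ℕ) :
    Integrable fun w => 𝓕 u w ^ (n + 1) := by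
  have hb : ∀ w, ‖𝓕 u w‖ ≤ ∫ x, ‖u x‖ := fun w =>
    VectorFourier.norm_fourierIntegral_le_integral_norm 𝐞 _ _ u w
  have hc : Continuous (𝓕 u) := VectorFourier.fourierIntegral_continuous
    Real.continuous_fourierChar (by exact continuous_inner) hu
  simp_rw [pow_succ]
  refine h.bdd_mul (c := (∫ x, ‖u x‖) ^ n) (hc.pow n).aestronglyMeasurable
    (Eventually.of_forall fun w => ?_)
  rw [norm_pow]
  exact pow_le_pow_left₀ (norm_nonneg _) (hb w) n

/-- Heavy-tail asymptotic (Eq. (22) of the paper). For integers `l ≥ 2`, `N ≥ 1`, with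
`σ = √(sin(π/(2l))/sin(3π/(2l)))` (so `σ²` is the variance of the density
`f_l(ξ) = (l/π) sin(π/(2l))/(1 + ξ^{2l})`), `g` the characteristic function of `f_l`, and
`p_N(z) = (1/(2π)) ∫ g(ω/(σ√N))^N e^{-iωz} dω` the density of the normalized sum, one has
`z^{2l} p_N(z) → N l sin(π/(2l)) / (π (σ√N)^{2l-1})` as `z → +∞`. -/
theorem stmt_11 (l N : ℕ) (hl : 2 ≤ l) (hN : 1 ≤ N)
    (σ : ℝ) (hσ : σ = Real.sqrt (Real.sin (π / (2 * l)) / Real.sin (3 * π / (2 * l))))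
    (g : ℝ → ℂ)
    (hg : ∀ t : ℝ, g t = ∫ ξ : ℝ, Complex.exp (Complex.I * t * ξ) *
      (((l / π) * Real.sin (π / (2 * l)) / (1 + ξ ^ (2 * l)) : ℝ) : ℂ))
    (p : ℝ → ℂ)
    (hp : ∀ z : ℝ, p z = (1 / (2 * π)) *
      ∫ ω : ℝ, g (ω / (σ * Real.sqrt N)) ^ N * Complex.exp (-Complex.I * ω * z)) :
    Tendsto (fun z : ℝ => (z : ℂ) ^ (2 * l) * p z) atTop
      (nhds (((N * l * Real.sin (π / (2 * l)) /
        (π * (σ * Real.sqrt N) ^ (2 * l - 1)) : ℝ) : ℂ))) := by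
  have hl' : (2 : ℝ) ≤ l := by exact_mod_cast hl
  have hπ := Real.pi_pos
  have hsin : 0 < Real.sin (π / (2 * l)) := by
    refine Real.sin_pos_of_pos_of_lt_pi (by positivity) ?_
    rw [div_lt_iff₀ (by positivity)]
    nlinarith
  have hsin3 : 0 < Real.sin (3 * π / (2 * l)) := by
    refine Real.sin_pos_of_pos_of_lt_pi (by positivity) ?_
    rw [div_lt_iff₀ (by positivity)]
    nlinarith
  have hσ0 : 0 < σ := hσ ▸ Real.sqrt_pos.2 (div_pos hsin hsin3)
  obtain ⟨n, rfl⟩ : ∃ n, N = n + 1 := ⟨N - 1, by omega⟩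
  set s : ℝ := σ * Real.sqrt (n + 1 : ℕ) with hs
  have hs0 : 0 < s := mul_pos hσ0 (Real.sqrt_pos.2 (by positivity))
  set c : ℝ := l / π * Real.sin (π / (2 * l)) with hc
  have hu := hasPowerTail_powerDensity hl c
  have hu1 : ∫ x, powerDensity l c x = 1 := by
    simp only [powerDensity, div_eq_mul_inv]
    rw [integral_complex_ofReal, integral_const_mul, integral_inv_one_add_pow hl, hc]
    rw [Complex.ofReal_eq_one]
    generalize Real.sin (π / (2 * l)) = S at hsin
    field_simp
  obtain ⟨F, hF, -, hFu⟩ := hu.exists_fourier_eq_pow hu1 n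
  have hFF : 𝓕 F = fun w => 𝓕 (powerDensity l c) w ^ (n + 1) := funext hFu
  have hinv := hF.continuous.fourierInv_fourier_eq hF.integrable
    (hFF ▸ integrable_fourier_pow hu.integrable (integrable_fourier_powerDensity hl c) n)
  have hgF : ∀ w : ℝ, g (-(2 * π * w)) = 𝓕 (powerDensity l c) w := fun w => by
    rw [hg, Real.fourier_eq']
    congr 1
    ext x
    simp only [powerDensity, smul_eq_mul, RCLike.inner_apply, conj_trivial]
    congr 2
    push_cast
    ring
  have hpF : ∀ z : ℝ, p z = s * F (s * z) := fun z => by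
    have hsub := Measure.integral_comp_mul_left
      (fun ω : ℝ => g (ω / s) ^ (n + 1) * Complex.exp (-Complex.I * ω * z)) (-(2 * π * s))
    have hint : ∫ v : ℝ, g (-(2 * π * s) * v / s) ^ (n + 1) *
        Complex.exp (-Complex.I * (-(2 * π * s) * v : ℝ) * z) = F (s * z) := by
      rw [← congrFun hinv (s * z), Real.fourierInv_eq']
      congr 1
      ext v
      rw [show -(2 * π * s) * v / s = -(2 * π * v) by field_simp, hgF, hFu, smul_eq_mul, mul_comm]
      simp only [RCLike.inner_apply, conj_trivial]
      congr 2
      push_cast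
      ring
    rw [hint, abs_inv, abs_neg, abs_of_pos (by positivity), Complex.real_smul] at hsub
    rw [hp, hsub]
    generalize (∫ ω : ℝ, g (ω / s) ^ (n + 1) * Complex.exp (-Complex.I * ω * z)) = J
    have : (s : ℂ) ≠ 0 := by exact_mod_cast hs0.ne'
    push_cast
    field_simp
  have hlim := (hF.tendsto.comp (tendsto_id.const_mul_atTop hs0)).const_mul
    (((s ^ (2 * l - 1))⁻¹ : ℝ) : ℂ)
  have hsc : (s : ℂ) ≠ 0 := by exact_mod_cast hs0.ne'
  convert! hlim using 1
  · ext z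
    have e : (s : ℂ) ^ (2 * l) = s ^ (2 * l - 1) * s := by rw [← pow_succ]; congr 1; omega
    simp only [hpF, Function.comp_apply, id]
    push_cast
    rw [mul_pow, e]
    field_simp
  · congr 1
    rw [hc]
    push_cast
    field_simp
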